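/- arXiv:1202.3369 — 5 statements merged into one kernel-verified Lean document; each statement's English description precedes it below -/
import Mathlib

section
/- A matrix A ∈ C_B is nilpotent if and only if the matrix A(i) is nilpotent for every i = 1,...,u. -/
open Matrix

/-- The nilpotent Jordan matrix which, for each `k : Fin u`, has `c k` Jordan blocks of
size `ν k`, realized on the index type `Σ k : Fin u, Fin (c k) × Fin (ν k)`. -/
def jordanMatrixM (K : Type*) [Field K] (u : ℕ) (c ν : Fin u → ℕ) :
    Matrix (Σ k : Fin u, Fin (c k) × Fin (ν k)) (Σ k : Fin u, Fin (c k) × Fin (ν k)) K :=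
  fun p q =>
    if p.1 = q.1 ∧ (p.2.1 : ℕ) = (q.2.1 : ℕ) ∧ (p.2.2 : ℕ) + 1 = (q.2.2 : ℕ) then 1 else 0

/-- For `A` commuting with `J` and a group `i` of Jordan blocks of equal size `ν i`,
`A(i)` is the `(c i) × (c i)` matrix of the constant diagonal values (the `(1,1)` entries)
of the Toeplitz blocks of `A` joining two Jordan blocks of size `ν i`. -/
def diagPart {K : Type*} [Field K] {u : ℕ} {c ν : Fin u → ℕ} (hν : ∀ k, 0 < ν k)
    (A : Matrix (Σ k : Fin u, Fin (c k) × Fin (ν k))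
      (Σ k : Fin u, Fin (c k) × Fin (ν k)) K)
    (i : Fin u) : Matrix (Fin (c i)) (Fin (c i)) K :=
  fun j k => A ⟨i, (j, ⟨0, hν i⟩)⟩ ⟨i, (k, ⟨0, hν i⟩)⟩

/-- A square matrix over a field is nilpotent if and only if its characteristic polynomial
divides a power of the indeterminate. -/
theorem Matrix.isNilpotent_iff_exists_charpoly_dvd_X_pow {K n : Type*} [Field K] [Fintype n]
    [DecidableEq n] (M : Matrix n n K) :
    IsNilpotent M ↔ ∃ N : ℕ, M.charpoly ∣ Polynomial.X ^ N := by
  constructor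
  · intro h
    have h' := (isNilpotent_charpoly_sub_pow_of_isNilpotent h).eq_zero
    exact ⟨_, (sub_eq_zero.mp h').dvd⟩
  · rintro ⟨N, q, hq⟩
    refine ⟨N, ?_⟩
    simpa [aeval_self_charpoly] using congrArg (Polynomial.aeval M) hq

/-- A block triangular matrix over a field is nilpotent if and only if all its diagonal blocks
are nilpotent. -/
theorem Matrix.BlockTriangular.isNilpotent_iff {K n α : Type*} [Field K] [Fintype n]
    [DecidableEq n] [LinearOrder α] {M : Matrix n n K} {b : n → α} (h : M.BlockTriangular b) :
    IsNilpotent M ↔ ∀ i, IsNilpotent (M.toSquareBlock b (b i)) := by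
  simp only [isNilpotent_iff_exists_charpoly_dvd_X_pow, h.charpoly]
  constructor
  · rintro ⟨N, hN⟩ i
    exact ⟨N, (Finset.dvd_prod_of_mem (fun a => (M.toSquareBlock b a).charpoly)
      (Finset.mem_image_of_mem b (Finset.mem_univ i))).trans hN⟩
  · intro H
    have H' : ∀ a ∈ Finset.univ.image b, ∃ N : ℕ,
        (M.toSquareBlock b a).charpoly ∣ Polynomial.X ^ N := by
      intro a ha
      obtain ⟨i, -, rfl⟩ := Finset.mem_image.mp ha
      exact H i
    choose! N hN using H'
    refine ⟨∑ a ∈ Finset.univ.image b, N a, ?_⟩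
    rw [← Finset.prod_pow_eq_pow_sum]
    exact Finset.prod_dvd_prod_of_dvd _ _ hN

/-- Nilpotency of a square matrix is invariant under reindexing. -/
theorem Matrix.isNilpotent_submatrix_equiv_iff {R m n : Type*} [CommRing R] [Fintype m] [Fintype n]
    [DecidableEq m] [DecidableEq n] (M : Matrix n n R) (e : m ≃ n) :
    IsNilpotent (M.submatrix e e) ↔ IsNilpotent M :=
  IsNilpotent.map_iff (reindexAlgEquiv R R e.symm).injective

section Centralizer

variable {K : Type*} [Field K] {u : ℕ} {c ν : Fin u → ℕ}
  {A : Matrix (Σ k : Fin u, Fin (c k) × Fin (ν k)) (Σ k : Fin u, Fin (c k) × Fin (ν k)) K}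

theorem mul_jordanMatrixM_apply_succ (p : Σ k : Fin u, Fin (c k) × Fin (ν k))
    {l : Fin u} (m : Fin (c l)) {b : ℕ} (hb : b + 1 < ν l) :
    (A * jordanMatrixM K u c ν) p ⟨l, m, ⟨b + 1, hb⟩⟩ = A p ⟨l, m, ⟨b, by omega⟩⟩ := by
  rw [mul_apply, Finset.sum_eq_single ⟨l, m, ⟨b, by omega⟩⟩]
  · simp [jordanMatrixM]
  · rintro ⟨l', m', b'⟩ - hne
    rw [jordanMatrixM, if_neg, mul_zero]
    rintro ⟨h, hm, hb'⟩
    apply hne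
    dsimp only at h hm hb'
    subst h
    obtain rfl : m' = m := Fin.ext hm
    obtain rfl : b' = ⟨b, Nat.lt_of_succ_lt hb⟩ := Fin.ext (Nat.succ_injective hb')
    rfl
  · simp

theorem mul_jordanMatrixM_apply_zero (p : Σ k : Fin u, Fin (c k) × Fin (ν k))
    {l : Fin u} (m : Fin (c l)) (hb : 0 < ν l) :
    (A * jordanMatrixM K u c ν) p ⟨l, m, ⟨0, hb⟩⟩ = 0 := by
  simp [mul_apply, jordanMatrixM]

theorem jordanMatrixM_mul_apply {k : Fin u} (j : Fin (c k)) {a : ℕ} (ha : a + 1 < ν k)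
    (q : Σ k : Fin u, Fin (c k) × Fin (ν k)) :
    (jordanMatrixM K u c ν * A) ⟨k, j, ⟨a, by omega⟩⟩ q = A ⟨k, j, ⟨a + 1, ha⟩⟩ q := by
  rw [mul_apply, Finset.sum_eq_single ⟨k, j, ⟨a + 1, ha⟩⟩]
  · simp [jordanMatrixM]
  · rintro ⟨l', m', b'⟩ - hne
    rw [jordanMatrixM, if_neg, zero_mul]
    rintro ⟨h, hm, hb'⟩
    apply hne
    dsimp only at h hm hb'
    subst h
    obtain rfl : j = m' := Fin.ext hm
    obtain rfl : b' = ⟨a + 1, ha⟩ := Fin.ext hb'.symm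
    rfl
  · simp

theorem jordanMatrixM_mul_apply_last {k : Fin u} (j : Fin (c k)) (a : Fin (ν k))
    (ha : (a : ℕ) + 1 = ν k) (q : Σ k : Fin u, Fin (c k) × Fin (ν k)) :
    (jordanMatrixM K u c ν * A) ⟨k, j, a⟩ q = 0 := by
  rw [mul_apply]
  refine Finset.sum_eq_zero ?_
  rintro ⟨l', m', b'⟩ -
  rw [jordanMatrixM, if_neg, zero_mul]
  rintro ⟨h, -, hb'⟩
  dsimp only at h hb'
  subst h
  have := b'.isLt
  omega

/-- The blocks of a matrix commuting with `jordanMatrixM` are Toeplitz. -/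
theorem apply_add_add_of_commute
    (hA : A * jordanMatrixM K u c ν = jordanMatrixM K u c ν * A)
    {k l : Fin u} (j : Fin (c k)) (m : Fin (c l)) (a b s : ℕ)
    (ha : a + s < ν k) (hb : b + s < ν l) :
    A ⟨k, j, ⟨a + s, ha⟩⟩ ⟨l, m, ⟨b + s, hb⟩⟩ =
      A ⟨k, j, ⟨a, by omega⟩⟩ ⟨l, m, ⟨b, by omega⟩⟩ := by
  induction s with
  | zero => rfl
  | succ s ih =>
    rw [← ih (by omega) (by omega)]
    have h := congrFun (congrFun hA ⟨k, j, ⟨a + s, by omega⟩⟩) ⟨l, m, ⟨b + s + 1, hb⟩⟩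
    exact (jordanMatrixM_mul_apply j ha _).symm.trans
      (h.symm.trans (mul_jordanMatrixM_apply_succ _ m hb))

theorem apply_eq_zero_of_commute_of_lt
    (hA : A * jordanMatrixM K u c ν = jordanMatrixM K u c ν * A)
    {k l : Fin u} (j : Fin (c k)) (m : Fin (c l))
    (a : Fin (ν k)) (b : Fin (ν l)) (hab : (b : ℕ) < a) : A ⟨k, j, a⟩ ⟨l, m, b⟩ = 0 := by
  obtain ⟨a, ha⟩ := a
  obtain ⟨b, hb⟩ := b
  obtain ⟨d, rfl⟩ : ∃ d, a = d + 1 + b := ⟨a - b - 1, by dsimp only at hab; omega⟩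
  have h := apply_add_add_of_commute hA j m (d + 1) 0 b ha (by omega)
  simp only [zero_add] at h
  rw [h, ← jordanMatrixM_mul_apply (A := A) j (by omega), ← hA, mul_jordanMatrixM_apply_zero]

theorem apply_eq_zero_of_commute_of_sub_lt
    (hA : A * jordanMatrixM K u c ν = jordanMatrixM K u c ν * A)
    {k l : Fin u} (j : Fin (c k)) (m : Fin (c l))
    (a : Fin (ν k)) (b : Fin (ν l)) (hab : ν k - a < ν l - b) : A ⟨k, j, a⟩ ⟨l, m, b⟩ = 0 := by
  obtain ⟨a, ha⟩ := a
  obtain ⟨b, hb⟩ := b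
  dsimp only at hab
  rw [← apply_add_add_of_commute hA j m a b (ν k - a - 1) (by omega) (by omega),
    ← mul_jordanMatrixM_apply_succ (A := A) _ m (by omega), hA, jordanMatrixM_mul_apply_last]
  dsimp only
  omega

/-- A matrix commuting with `jordanMatrixM` is block triangular once the basis vectors are sorted
first by their position within the Jordan block and then by the group of the block. -/
theorem blockTriangular_of_commute
    (hA : A * jordanMatrixM K u c ν = jordanMatrixM K u c ν * A)
    (hν : StrictAnti ν) :
    A.BlockTriangular fun p => toLex ((p.2.2 : ℕ), p.1) := by
  rintro ⟨k, j, a⟩ ⟨l, m, b⟩ h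
  rcases Prod.Lex.toLex_lt_toLex.mp h with h | ⟨h, hlk⟩
  · exact apply_eq_zero_of_commute_of_lt hA j m a b h
  · refine apply_eq_zero_of_commute_of_sub_lt hA j m a b ?_
    have := hν hlk
    have := a.isLt
    dsimp only at *
    omega

end Centralizer

/-- The Jordan blocks in the group `k` correspond to the basis vectors at position `a` of the
blocks in that group. -/
def positionFiberEquiv {u : ℕ} (c ν : Fin u → ℕ) (k : Fin u) (a : Fin (ν k)) :
    Fin (c k) ≃ {p : Σ k : Fin u, Fin (c k) × Fin (ν k) //
      toLex ((p.2.2 : ℕ), p.1) = toLex ((a : ℕ), k)} where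
  toFun j := ⟨⟨k, j, a⟩, rfl⟩
  invFun p := Fin.cast (congrArg (fun x => c (ofLex x).2) p.2) p.1.2.1
  left_inv _ := rfl
  right_inv := by
    rintro ⟨⟨k', j, b⟩, h⟩
    obtain ⟨hb, rfl⟩ := Prod.mk.inj (toLex.injective h)
    obtain rfl : b = a := Fin.ext hb
    rfl

/-- A matrix `A` in the centralizer `C_B` of the Jordan matrix `J` of type `B` is nilpotent
if and only if the matrix `A(i)` is nilpotent for every `i = 1, ..., u`. -/
theorem nilpotent_iff_diagParts_nilpotent
    (K : Type*) [Field K]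
    (u : ℕ) (ν c : Fin u → ℕ)
    (hνanti : StrictAnti ν) (hνpos : ∀ k, 0 < ν k) (hcpos : ∀ k, 0 < c k)
    (A : Matrix (Σ k : Fin u, Fin (c k) × Fin (ν k))
      (Σ k : Fin u, Fin (c k) × Fin (ν k)) K)
    (hA : A * jordanMatrixM K u c ν = jordanMatrixM K u c ν * A) :
    IsNilpotent A ↔ ∀ i : Fin u, IsNilpotent (diagPart hνpos A i) := by
  rw [(blockTriangular_of_commute hA hνanti).isNilpotent_iff]
  have key (k : Fin u) (j : Fin (c k)) (a : Fin (ν k)) :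
      IsNilpotent (A.toSquareBlock (fun p => toLex ((p.2.2 : ℕ), p.1)) (toLex ((a : ℕ), k))) ↔
        IsNilpotent (diagPart hνpos A k) := by
    rw [← isNilpotent_submatrix_equiv_iff _ (positionFiberEquiv c ν k a)]
    refine iff_of_eq (congrArg IsNilpotent ?_)
    ext i m
    have h := apply_add_add_of_commute hA i m 0 0 a (by omega) (by omega)
    simp only [zero_add] at h
    exact h
  exact ⟨fun h i => (key i ⟨0, hcpos i⟩ ⟨0, hνpos i⟩).mp (h ⟨i, ⟨0, hcpos i⟩, ⟨0, hνpos i⟩⟩),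
    fun h p => (key p.1 p.2.1 p.2.2).mpr (h p.1)⟩
end

section
/- The relation R_B on the index set I = {(i,j,l) : 1 ≤ i ≤ u, 1 ≤ j ≤ q_i − q_{i−1}, 1 ≤ l ≤ μ_{q_i}}, defined by (i',j',l') R_B (i,j,l) if and only if one of the following holds: (ι1) i < i' and μ_{q_i} − l ≤ μ_{q_{i'}} − l'; (ι2) i = i', j ≥ j' and l > l'; (ι3) i > i' and l ≥ l', or i = i', j < j' and l ≥ l'; is a strict partial order (irreflexive and transitive). -/
/-- Membership in the index set
`I = {(i,j,l) : 1 ≤ i ≤ u, 1 ≤ j ≤ q_i - q_{i-1}, 1 ≤ l ≤ μ_{q_i}}` for a partition with,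
for each `i : Fin u`, `c i` parts equal to `ν i` (here `i` is 0-indexed while `j, l` are
1-indexed). -/
def MemIndex {u : ℕ} (ν c : Fin u → ℕ) (p : Fin u × ℕ × ℕ) : Prop :=
  1 ≤ p.2.1 ∧ p.2.1 ≤ c p.1 ∧ 1 ≤ p.2.2 ∧ p.2.2 ≤ ν p.1

/-- The relation `R_B`: `(i',j',l') R_B (i,j,l)` iff
(ι1) `i < i'` and `ν i - l ≤ ν i' - l'`; or
(ι2) `i = i'`, `j ≥ j'` and `l > l'`; or
(ι3) `i > i'` and `l ≥ l'`, or `i = i'`, `j < j'` and `l ≥ l'`. -/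
def RelB {u : ℕ} (ν : Fin u → ℕ) (p' p : Fin u × ℕ × ℕ) : Prop :=
  (p.1 < p'.1 ∧ ν p.1 - p.2.2 ≤ ν p'.1 - p'.2.2) ∨
  (p.1 = p'.1 ∧ p'.2.1 ≤ p.2.1 ∧ p'.2.2 < p.2.2) ∨
  ((p'.1 < p.1 ∧ p'.2.2 ≤ p.2.2) ∨ (p.1 = p'.1 ∧ p.2.1 < p'.2.1 ∧ p'.2.2 ≤ p.2.2))

/-- The relation `R_B` on the index set `I` is a strict partial order: irreflexive and
transitive.  Here `ν` lists the distinct part sizes of `B` in strictly decreasing order and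
`c` their multiplicities. -/
theorem RelB_strict_partial_order
    (u : ℕ) (ν c : Fin u → ℕ)
    (hνanti : StrictAnti ν) (hνpos : ∀ k, 0 < ν k) (hcpos : ∀ k, 0 < c k) :
    (∀ p : Fin u × ℕ × ℕ, MemIndex ν c p → ¬ RelB ν p p) ∧
    (∀ p q r : Fin u × ℕ × ℕ, MemIndex ν c p → MemIndex ν c q → MemIndex ν c r →
      RelB ν p q → RelB ν q r → RelB ν p r) := by
  refine ⟨fun p _ h => ?_, ?_⟩
  · simp [RelB] at h
  · rintro ⟨i₁, j₁, l₁⟩ ⟨i₂, j₂, l₂⟩ ⟨i₃, j₃, l₃⟩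
    have ν_cases : ∀ a b, (a < b ∧ ν b < ν a) ∨ (a = b ∧ ν a = ν b) ∨ (b < a ∧ ν a < ν b) := by
      intro a b
      rcases lt_trichotomy a b with h | h | h
      · exact .inl ⟨h, hνanti h⟩
      · exact .inr (.inl ⟨h, congrArg ν h⟩)
      · exact .inr (.inr ⟨h, hνanti h⟩)
    have h₁₂ := ν_cases i₁ i₂
    have h₂₃ := ν_cases i₂ i₃
    have h₁₃ := ν_cases i₁ i₃
    simp only [MemIndex, RelB]
    omega
end

section
/- Let X ∈ M(n,K) be nilpotent with index of nilpotency ω (X^ω = 0 and X^{ω−1} ≠ 0) and let v ∈ K^n satisfy X^{ω−1}v ≠ 0. Then there exists a subspace V ⊆ K^n with X(V) ⊆ V and V ⊕ span(v, Xv, ..., X^{ω−1}v) = K^n. -/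
open Matrix

/-- If `Φ ∘ Ψ` is bijective, then `ker Φ` and `range Ψ` are complementary. -/
theorem LinearMap.isCompl_ker_range_of_bijective_comp {R E F G : Type*} [Ring R]
    [AddCommGroup E] [Module R E] [AddCommGroup F] [Module R F] [AddCommGroup G] [Module R G]
    (Φ : E →ₗ[R] F) (Ψ : G →ₗ[R] E) (h : Function.Bijective (Φ ∘ₗ Ψ)) :
    IsCompl (LinearMap.ker Φ) (LinearMap.range Ψ) := by
  constructor
  · rw [Submodule.disjoint_def]
    rintro _ hx ⟨c, rfl⟩
    have hc : (Φ ∘ₗ Ψ) c = (Φ ∘ₗ Ψ) 0 := by simpa using hx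
    rw [h.1 hc, map_zero]
  · rw [codisjoint_iff, eq_top_iff]
    intro x _
    obtain ⟨c, hc⟩ := h.2 (Φ x)
    have hc' : Φ (Ψ c) = Φ x := hc
    exact Submodule.mem_sup.2
      ⟨x - Ψ c, by simp [hc'], Ψ c, LinearMap.mem_range_self Ψ c, sub_add_cancel x (Ψ c)⟩

/-- A cyclic subspace of maximal length of a nilpotent endomorphism has an invariant complement. -/
theorem Module.End.exists_invariant_isCompl_span_pow {K E : Type*} [Field K] [AddCommGroup E]
    [Module K E] (T : Module.End K E) (m : ℕ) (hT : T ^ m = 0) (v : E)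
    (hv : (T ^ (m - 1)) v ≠ 0) :
    ∃ V : Submodule K E, (∀ w ∈ V, T w ∈ V) ∧
      IsCompl V (Submodule.span K (Set.range fun k : Fin m => (T ^ (k : ℕ)) v)) := by
  have hzero : ∀ k, m ≤ k → T ^ k = 0 := fun k hk => pow_eq_zero_of_le hk hT
  obtain ⟨f, hf⟩ := Module.Projective.exists_dual_ne_zero K hv
  let Φ : E →ₗ[K] (Fin m → K) := LinearMap.pi fun k => f ∘ₗ T ^ (k : ℕ)
  let Ψ : (Fin m → K) →ₗ[K] E := Fintype.linearCombination K fun k : Fin m => (T ^ (k : ℕ)) v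
  have hinj : Function.Injective (Φ ∘ₗ Ψ) := by
    rw [← LinearMap.ker_eq_bot, LinearMap.ker_eq_bot']
    intro c hc
    suffices h : ∀ i (hi : i < m), c ⟨i, hi⟩ = 0 from funext fun i => h i i.2
    intro i
    induction i using Nat.strong_induction_on with
    | _ i ih =>
      intro hi
      have key : ∑ j : Fin m, c j * f ((T ^ (m - 1 - i + j)) v) = 0 := by
        simpa [Φ, Ψ, Fintype.linearCombination_apply, pow_add]
          using congrFun hc ⟨m - 1 - i, by omega⟩
      rw [Finset.sum_eq_single ⟨i, hi⟩ _ (by simp)] at key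
      · rw [show m - 1 - i + i = m - 1 by omega] at key
        exact (mul_eq_zero.1 key).resolve_right hf
      · intro j _ hj
        rcases lt_or_gt_of_ne (fun h : (j : ℕ) = i => hj (Fin.ext h)) with h | h
        · rw [ih j h j.2, zero_mul]
        · rw [hzero _ (by omega), LinearMap.zero_apply, map_zero, mul_zero]
  refine ⟨LinearMap.ker Φ, fun w hw => ?_, ?_⟩
  · have hw' : ∀ k, f ((T ^ k) w) = 0 := fun k => by
      by_cases hk : k < m
      · exact congrFun (LinearMap.mem_ker.1 hw) ⟨k, hk⟩
      · rw [hzero k (not_lt.1 hk), LinearMap.zero_apply, map_zero]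
    refine LinearMap.mem_ker.2 (funext fun k => ?_)
    simpa [Φ, pow_succ] using hw' (k + 1)
  · rw [← Fintype.range_linearCombination]
    exact LinearMap.isCompl_ker_range_of_bijective_comp Φ Ψ
      ⟨hinj, LinearMap.injective_iff_surjective.1 hinj⟩

/-- If `X ∈ M(n,K)` is nilpotent of nilpotency index `ω` and `v ∈ K^n` satisfies
`X^{ω-1} v ≠ 0`, then there is an `X`-invariant subspace `V ⊆ K^n` with
`V ⊕ span(v, Xv, ..., X^{ω-1}v) = K^n`. -/
theorem exists_invariant_complement
    (K : Type*) [Field K] (n : ℕ)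
    (X : Matrix (Fin n) (Fin n) K) (ω : ℕ) (hω : 0 < ω)
    (hnil : X ^ ω = 0) (hind : X ^ (ω - 1) ≠ 0)
    (v : Fin n → K) (hv : (X ^ (ω - 1)) *ᵥ v ≠ 0) :
    ∃ V : Submodule K (Fin n → K),
      (∀ w ∈ V, X *ᵥ w ∈ V) ∧
      IsCompl V (Submodule.span K (Set.range fun k : Fin ω => (X ^ (k : ℕ)) *ᵥ v)) := by
  have hpow : ∀ k w, (X.toLin' ^ k) w = (X ^ k) *ᵥ w := fun k w => by
    rw [← Matrix.toLin'_pow, Matrix.toLin'_apply]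
  obtain ⟨V, hV, hc⟩ := Module.End.exists_invariant_isCompl_span_pow X.toLin' ω
    (by rw [← Matrix.toLin'_pow, hnil, map_zero]) v (by rwa [hpow])
  simp only [hpow] at hc
  exact ⟨V, hV, hc⟩
end

section
/- Let X be a nilpotent endomorphism of K^n with index of nilpotency ω and let v ∈ K^n satisfy X^{ω−1}v ≠ 0. Let W = span(v, Xv, ..., X^{ω−1}v) and let X̄ be the endomorphism induced by X on the quotient K^n/W. Then for every m ∈ ℕ, rank X^m = rank X̄^m + max(ω − m, 0); equivalently, the Jordan type of X is obtained from the Jordan type of X̄ by adjoining one part equal to ω. -/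
open Module

theorem linearIndependent_pow_apply_of_pow_apply_ne_zero {K V : Type*} [Field K] [AddCommGroup V]
    [Module K V] (X : Module.End K V) (d : ℕ) (w : V) (hd : (X ^ d) w = 0)
    (hne : 0 < d → (X ^ (d - 1)) w ≠ 0) :
    LinearIndependent K (fun k : Fin d => (X ^ (k : ℕ)) w) := by
  induction d generalizing w with
  | zero => exact linearIndependent_empty_type
  | succ d ih =>
    have htail : Fin.tail (fun k : Fin (d + 1) => (X ^ (k : ℕ)) w) =
        fun k : Fin d => (X ^ (k : ℕ)) (X w) := by
      funext k
      simp [Fin.tail, pow_succ]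
    rw [linearIndependent_finSucc, htail]
    refine ⟨ih (X w) (by simpa [pow_succ] using hd) fun h => ?_, fun hmem => ?_⟩
    · obtain ⟨e, rfl⟩ := Nat.exists_eq_succ_of_ne_zero h.ne'
      simpa [pow_succ] using hne (Nat.succ_pos _)
    · have hle : Submodule.span K (Set.range fun k : Fin d => (X ^ (k : ℕ)) (X w)) ≤
          LinearMap.ker (X ^ d) := by
        rw [Submodule.span_le]
        rintro _ ⟨k, rfl⟩
        have : (X ^ d) ((X ^ (k : ℕ)) (X w)) = (X ^ (k : ℕ)) ((X ^ (d + 1)) w) := by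
          simp only [← Module.End.mul_apply, ← pow_add, ← pow_succ]
          congr 2
          omega
        simp [this, hd]
      exact hne (Nat.succ_pos _) (by simpa using hle hmem)

theorem finrank_map_pow_span_pow_apply {K V : Type*} [Field K] [AddCommGroup V]
    [Module K V] (X : Module.End K V) (d : ℕ) (w : V) (hd : (X ^ d) w = 0)
    (hne : (X ^ (d - 1)) w ≠ 0) (j : ℕ) :
    finrank K ((Submodule.span K (Set.range fun k : Fin d => (X ^ (k : ℕ)) w)).map (X ^ j)) =
      d - j := by
  have hzero : ∀ i, d ≤ i → (X ^ i) w = 0 := fun i hi => by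
    rw [← Nat.sub_add_cancel hi, pow_add, Module.End.mul_apply, hd, map_zero]
  have hspan : (Submodule.span K (Set.range fun k : Fin d => (X ^ (k : ℕ)) w)).map (X ^ j) =
      Submodule.span K (Set.range fun k : Fin (d - j) => (X ^ (k : ℕ)) ((X ^ j) w)) := by
    rw [Submodule.map_span]
    apply le_antisymm <;> rw [Submodule.span_le]
    · rintro _ ⟨_, ⟨k, rfl⟩, rfl⟩
      simp only [← Module.End.mul_apply, ← pow_add]
      by_cases h : (k : ℕ) < d - j
      · exact Submodule.subset_span ⟨⟨k, h⟩, by simp only [add_comm]⟩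
      · rw [hzero _ (by omega)]
        exact zero_mem _
    · rintro _ ⟨k, rfl⟩
      refine Submodule.subset_span ⟨_, ⟨⟨k, by omega⟩, rfl⟩, ?_⟩
      simp only [← Module.End.mul_apply, ← pow_add, add_comm]
  rw [hspan, finrank_span_eq_card, Fintype.card_fin]
  refine linearIndependent_pow_apply_of_pow_apply_ne_zero X _ _ ?_ fun h => ?_
  · rw [← Module.End.mul_apply, ← pow_add]
    exact hzero _ (by omega)
  · rw [← Module.End.mul_apply, ← pow_add]
    convert hne using 3
    omega

theorem finrank_map_add_finrank_inf_ker {K V V' : Type*} [Field K] [AddCommGroup V]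
    [Module K V] [FiniteDimensional K V] [AddCommGroup V'] [Module K V'] (f : V →ₗ[K] V')
    (P : Submodule K V) :
    finrank K (P.map f) + finrank K (P ⊓ LinearMap.ker f : Submodule K V) = finrank K P := by
  rw [← LinearMap.finrank_range_add_finrank_ker (f.domRestrict P), LinearMap.range_domRestrict,
    LinearMap.ker_domRestrict, ← Submodule.map_comap_subtype, Submodule.finrank_map_subtype_eq]

open Module

/-- Let `X` be a nilpotent endomorphism of `K^n` of nilpotency index `ω` and `v ∈ K^n` with
`X^{ω-1} v ≠ 0`.  Let `W = span(v, Xv, ..., X^{ω-1}v)` (an `X`-invariant subspace) and let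
`X̄` be the endomorphism induced by `X` on `K^n / W`.  Then for every `m`,
`rank X^m = rank X̄^m + max (ω - m) 0`; i.e. the Jordan type of `X` is that of `X̄` with one
part `ω` adjoined. -/
theorem rank_pow_quotient
    (K : Type*) [Field K] (n : ℕ)
    (X : Module.End K (Fin n → K)) (ω : ℕ) (hω : 0 < ω)
    (hnil : X ^ ω = 0) (hind : X ^ (ω - 1) ≠ 0)
    (v : Fin n → K) (hv : (X ^ (ω - 1)) v ≠ 0)
    (W : Submodule K (Fin n → K))
    (hW : W = Submodule.span K (Set.range fun k : Fin ω => (X ^ (k : ℕ)) v))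
    (hWinv : W ≤ W.comap X) :
    ∀ m : ℕ,
      Module.finrank K (LinearMap.range (X ^ m)) =
        Module.finrank K (LinearMap.range ((Submodule.mapQ W W X hWinv) ^ m)) + (ω - m) := by
  intro m
  have hrange : LinearMap.range ((Submodule.mapQ W W X hWinv) ^ m) =
      (LinearMap.range (X ^ m)).map W.mkQ := by
    rw [← Submodule.mapQ_pow, Submodule.range_mapQ]
  have hrank := finrank_map_add_finrank_inf_ker W.mkQ (LinearMap.range (X ^ m))
  rw [Submodule.ker_mkQ] at hrank
  rw [hrange, ← hrank]
  congr 1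
  have hmap : ∀ j, finrank K (W.map (X ^ j)) = ω - j := fun j => by
    rw [hW]
    exact finrank_map_pow_span_pow_apply X ω v (by simp [hnil]) hv j
  have hWrank : finrank K W = ω := by
    have h := hmap 0
    rwa [pow_zero, Module.End.one_eq_id, Submodule.map_id, Nat.sub_zero] at h
  apply le_antisymm
  · rcases le_total ω m with h | h
    · have : X ^ m = 0 := pow_eq_zero_of_le h hnil
      rw [this, LinearMap.range_zero, bot_inf_eq, finrank_bot]
      exact Nat.zero_le _
    · have hker : LinearMap.range (X ^ m) ⊓ W ≤ W ⊓ LinearMap.ker (X ^ (ω - m)) := by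
        rintro _ ⟨⟨y, rfl⟩, hy⟩
        refine ⟨hy, ?_⟩
        rw [SetLike.mem_coe, LinearMap.mem_ker, ← Module.End.mul_apply, ← pow_add, Nat.sub_add_cancel h, hnil,
          LinearMap.zero_apply]
      have := finrank_map_add_finrank_inf_ker (X ^ (ω - m)) W
      rw [hmap, hWrank] at this
      have := Submodule.finrank_mono hker
      omega
  · rw [← hmap m]
    refine Submodule.finrank_mono (le_inf LinearMap.map_le_range ?_)
    rw [Submodule.map_le_iff_le_comap]
    exact Submodule.le_comap_pow_of_le_comap W hWinv m
end

section
/- Suppose K is an infinite field. Then there exists A ∈ N_B with A^{n−1} ≠ 0 (equivalently Q(B) = (n)) if and only if B is almost rectangular, i.e. μ_1 − μ_t ≤ 1. -/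
open Matrix

/-- The Jordan matrix of the partition `μ`. -/
def jordanMatrix (K : Type*) [Field K] (t : ℕ) (μ : Fin t → ℕ) :
    Matrix (Σ i : Fin t, Fin (μ i)) (Σ i : Fin t, Fin (μ i)) K :=
  fun p q => if p.1 = q.1 ∧ (p.2 : ℕ) + 1 = (q.2 : ℕ) then 1 else 0

open Polynomial in
/-- Every nonzero polynomial agrees up to a unit with a power of `X` modulo `X ^ N`. -/
theorem exists_X_pow_factorization {K : Type*} [Field K] (N : ℕ) {f : K[X]} (hf : f ≠ 0) :
    ∃ (a : ℕ) (p u w : K[X]), a ≤ f.natDegree ∧ f = X ^ a * p ∧ u * p + w * X ^ N = 1 := by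
  obtain ⟨p, hp, hnd⟩ := exists_eq_pow_rootMultiplicity_mul_and_not_dvd f hf 0
  rw [C_0, sub_zero] at hp hnd
  have hcop : IsCoprime p (X ^ N) :=
    ((prime_X.irreducible.coprime_iff_not_dvd.mpr hnd).symm).pow_right
  obtain ⟨u, w, huw⟩ := hcop
  refine ⟨_, p, u, w, ?_, hp, huw⟩
  simpa using natDegree_le_of_dvd (Dvd.intro p hp.symm) hf

section RegularNilpotent

open Polynomial

variable {K V : Type*} [Field K] [AddCommGroup V] [Module K V]

theorem aeval_unit_mod_nilpotent {A : Module.End K V} {N : ℕ} (hN : A ^ N = 0) {p u w : K[X]}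
    (h : u * p + w * X ^ N = 1) (x : V) : aeval A u (aeval A p x) = x := by
  have := congrArg (fun q : K[X] => aeval A q x) h
  simpa [hN] using this

/-- A nilpotent endomorphism whose power `dim V - 1` is nonzero has a cyclic vector. -/
theorem exists_cyclic_vector [FiniteDimensional K V] {A : Module.End K V} (hA : IsNilpotent A)
    (hpow : A ^ (Module.finrank K V - 1) ≠ 0) :
    ∃ v : V, ∀ x : V, ∃ f : K[X], x = aeval A f v := by
  obtain ⟨N, hN⟩ := hA
  obtain ⟨v, hv⟩ : ∃ v, (A ^ (Module.finrank K V - 1)) v ≠ 0 := by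
    by_contra! h
    exact hpow (LinearMap.ext h)
  set n := Module.finrank K V with hn
  let φ : degreeLT K n →ₗ[K] V :=
    (LinearMap.applyₗ v ∘ₗ (aeval A).toLinearMap) ∘ₗ (degreeLT K n).subtype
  have hinj : Function.Injective φ := by
    rw [← LinearMap.ker_eq_bot, LinearMap.ker_eq_bot']
    rintro ⟨f, hf⟩ h0
    have h0' : aeval A f v = 0 := h0
    by_contra hne
    have hf0 : f ≠ 0 := fun h => hne (Subtype.ext h)
    obtain ⟨a, p, u, w, ha, hfp, huw⟩ := exists_X_pow_factorization N hf0
    have hlt : f.natDegree < n := (natDegree_lt_iff_degree_lt hf0).mpr (mem_degreeLT.mp hf)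
    have hav : (A ^ a) v = 0 := by
      have h1 := aeval_unit_mod_nilpotent hN huw ((A ^ a) v)
      rw [← h1]
      have h2 : aeval A p ((A ^ a) v) = aeval A f v := by
        rw [hfp, mul_comm]
        simp
      rw [h2, h0', map_zero]
    apply hv
    rw [show n - 1 = (n - 1 - a) + a by omega, pow_add, Module.End.mul_apply, hav, map_zero]
  have hfin : Module.finrank K (degreeLT K n) = Module.finrank K V := by
    rw [(degreeLTEquiv K n).finrank_eq, Module.finrank_fin_fun]
  have : FiniteDimensional K (degreeLT K n) := (degreeLTEquiv K n).symm.finiteDimensional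
  have hsurj : Function.Surjective φ :=
    (LinearMap.injective_iff_surjective_of_finrank_eq_finrank hfin).mp hinj
  refine ⟨v, fun x => ?_⟩
  obtain ⟨f, hf⟩ := hsurj x
  exact ⟨f, hf.symm⟩

/-- The cyclic submodules of a regular nilpotent endomorphism are totally ordered. -/
theorem exists_aeval_eq_or_exists_aeval_eq [FiniteDimensional K V] {A : Module.End K V}
    (hA : IsNilpotent A) (hpow : A ^ (Module.finrank K V - 1) ≠ 0) (x y : V) :
    (∃ f : K[X], y = aeval A f x) ∨ ∃ f : K[X], x = aeval A f y := by
  obtain ⟨v, hv⟩ := exists_cyclic_vector hA hpow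
  obtain ⟨N, hN⟩ := hA
  obtain ⟨f, rfl⟩ := hv x
  obtain ⟨g, rfl⟩ := hv y
  rcases eq_or_ne f 0 with rfl | hf
  · exact Or.inr ⟨0, by simp⟩
  rcases eq_or_ne g 0 with rfl | hg
  · exact Or.inl ⟨0, by simp⟩
  obtain ⟨a, p, u, w, -, rfl, hu⟩ := exists_X_pow_factorization N hf
  obtain ⟨b, q, u', w', -, rfl, hu'⟩ := exists_X_pow_factorization N hg
  have key : ∀ (a b : ℕ) (p q u w : K[X]), a ≤ b → u * p + w * X ^ N = 1 →
      aeval A (X ^ b * q) v = aeval A (X ^ (b - a) * q * u) (aeval A (X ^ a * p) v) := by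
    intro a b p q u w hab h
    have h1 := aeval_unit_mod_nilpotent hN h (aeval A (X ^ b * q) v)
    rw [← h1]
    simp only [← Module.End.mul_apply, ← map_mul]
    congr 2
    obtain ⟨c, rfl⟩ := Nat.exists_eq_add_of_le hab
    rw [Nat.add_sub_cancel_left]
    ring
  rcases le_total a b with h | h
  · exact Or.inl ⟨_, key a b p q u w h hu⟩
  · exact Or.inr ⟨_, key b a q p u' w' h hu'⟩

/-- If `J` commutes with a regular nilpotent `A` and `ker J` is not contained in the range of
`J ^ m`, then `J ^ (m + 1) = 0`. -/
theorem pow_succ_eq_zero_of_commute_regular [FiniteDimensional K V] {A J : Module.End K V}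
    (hA : IsNilpotent A) (hpow : A ^ (Module.finrank K V - 1) ≠ 0) (hAJ : Commute A J) {m : ℕ}
    {y : V} (hy : J y = 0) (hym : ∀ z, (J ^ m) z ≠ y) : J ^ (m + 1) = 0 := by
  ext z
  have hcomm : ∀ f : K[X], Commute (aeval A f) J := fun f => by
    simpa [Commute, SemiconjBy] using
      (Algebra.commute_of_mem_adjoin_singleton_of_commute
        (aeval_mem_adjoin_singleton K A) hAJ.symm).symm
  rw [pow_succ', Module.End.mul_apply, LinearMap.zero_apply]
  rcases exists_aeval_eq_or_exists_aeval_eq hA hpow ((J ^ m) z) y with ⟨f, hf⟩ | ⟨f, hf⟩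
  · refine absurd ?_ (hym (aeval A f z))
    rw [hf, ← Module.End.mul_apply, ← Module.End.mul_apply, ((hcomm f).pow_right m).eq]
  · rw [hf, ← Module.End.mul_apply, ← (hcomm f).eq, Module.End.mul_apply, hy, map_zero]

end RegularNilpotent

theorem jordanMatrix_pow_apply (K : Type*) [Field K] (t : ℕ) (μ : Fin t → ℕ) (m : ℕ)
    (p q : Σ i : Fin t, Fin (μ i)) :
    (jordanMatrix K t μ ^ m) p q = if p.1 = q.1 ∧ (p.2 : ℕ) + m = (q.2 : ℕ) then 1 else 0 := by
  induction m generalizing p with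
  | zero =>
    rw [pow_zero, Matrix.one_apply]
    obtain ⟨i, a⟩ := p
    obtain ⟨j, b⟩ := q
    refine if_congr ⟨?_, ?_⟩ rfl rfl
    · rintro ⟨⟩
      simp
    · rintro ⟨h, h'⟩
      dsimp only at h h'
      subst h
      rw [Fin.ext h']
  | succ m ih =>
    rw [pow_succ', Matrix.mul_apply]
    simp only [ih, jordanMatrix]
    obtain ⟨i, a⟩ := p
    obtain ⟨j, b⟩ := q
    by_cases h : i = j ∧ (a : ℕ) + (m + 1) = b
    · obtain ⟨rfl, h⟩ := h
      have ha : (a : ℕ) + 1 < μ i := by omega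
      rw [Finset.sum_eq_single ⟨i, ⟨a + 1, ha⟩⟩]
      · simp only [true_and, ↓reduceIte, one_mul]
        refine if_congr ?_ rfl rfl
        omega
      · rintro ⟨k, c⟩ - hc
        rw [if_neg, zero_mul]
        rintro ⟨h1, h2⟩
        dsimp only at h1 h2
        subst h1
        exact hc (by congr 1; exact Fin.ext h2.symm)
      · simp
    · rw [if_neg h]
      refine Finset.sum_eq_zero ?_
      rintro ⟨k, c⟩ -
      rw [ite_zero_mul_ite_zero, mul_one, if_neg]
      rintro ⟨⟨h1, h2⟩, h3, h4⟩
      exact h ⟨h1.trans h3, by dsimp only at h2 h4 ⊢; omega⟩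

/-- The nilpotent Jordan block of size `n`. -/
def shiftMatrix (K : Type*) [Field K] (n : ℕ) : Matrix (Fin n) (Fin n) K :=
  fun p q => if (p : ℕ) + 1 = q then 1 else 0

theorem shiftMatrix_pow_apply (K : Type*) [Field K] (n m : ℕ) (p q : Fin n) :
    (shiftMatrix K n ^ m) p q = if (p : ℕ) + m = q then 1 else 0 := by
  induction m generalizing p with
  | zero => simp [Matrix.one_apply, Fin.ext_iff]
  | succ m ih =>
    rw [pow_succ', Matrix.mul_apply]
    simp only [ih, shiftMatrix]
    by_cases h : (p : ℕ) + (m + 1) = q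
    · have hp : (p : ℕ) + 1 < n := by omega
      rw [Finset.sum_eq_single ⟨p + 1, hp⟩]
      · simp only [↓reduceIte, one_mul]
        refine if_congr ?_ rfl rfl
        omega
      · intro c _ hc
        rw [if_neg, zero_mul]
        exact fun h => hc (Fin.ext h.symm)
      · simp
    · rw [if_neg h]
      refine Finset.sum_eq_zero fun c _ => ?_
      rw [ite_zero_mul_ite_zero, mul_one, if_neg]
      omega

/-- For an almost rectangular partition, reading the Jordan basis column by column enumerates it
without gaps. -/
theorem exists_column_enumeration (t : ℕ) (ht : 0 < t) (μ : Fin t → ℕ)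
    (hmono : ∀ i j : Fin t, i ≤ j → μ j ≤ μ i)
    (h : μ ⟨0, ht⟩ ≤ μ ⟨t - 1, Nat.sub_lt ht Nat.one_pos⟩ + 1) :
    ∃ e : (Σ i : Fin t, Fin (μ i)) ≃ Fin (∑ i, μ i), ∀ p, (e p : ℕ) = t * p.2 + p.1 := by
  let pos : (Σ i : Fin t, Fin (μ i)) → ℕ := fun p => t * p.2 + p.1
  have hdiv : ∀ p, pos p / t = p.2 := fun p => by
    simp [pos, Nat.mul_add_div ht, Nat.div_eq_of_lt p.1.2]
  have hmod : ∀ p, pos p % t = p.1 := fun p => by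
    simp [pos, Nat.mod_eq_of_lt p.1.2]
  have hinj : Function.Injective pos := by
    rintro ⟨i, a⟩ ⟨j, b⟩ hab
    have h1 := hdiv ⟨i, a⟩
    have h2 := hmod ⟨i, a⟩
    rw [hab, hdiv] at h1
    rw [hab, hmod] at h2
    dsimp only at h1 h2
    obtain rfl := Fin.ext h2
    rw [Fin.ext h1]
  have hpred : ∀ p a, pos p = a + 1 → ∃ q, pos q = a := by
    rintro ⟨⟨i, hi⟩, ⟨j, hj⟩⟩ a hp
    simp only [pos] at hp
    rcases i with _ | i
    · obtain ⟨j, rfl⟩ : ∃ j', j = j' + 1 := ⟨j - 1, by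
        rcases j with _ | j <;> simp at hp ⊢⟩
      refine ⟨⟨⟨t - 1, Nat.sub_lt ht Nat.one_pos⟩, ⟨j, by omega⟩⟩, ?_⟩
      simp only [pos]
      rw [mul_add] at hp
      omega
    · have := hmono ⟨i, by omega⟩ ⟨i + 1, hi⟩ (by simp [Fin.le_def])
      exact ⟨⟨⟨i, by omega⟩, ⟨j, by omega⟩⟩, by simp only [pos]; omega⟩
  have hdown : ∀ d a, (∃ p, pos p = a + d) → ∃ q, pos q = a := by
    intro d
    induction d with
    | zero => exact fun a h => h
    | succ d ih =>
      rintro a ⟨p, hp⟩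
      exact ih a (hpred p _ hp)
  have hcard : Fintype.card (Σ i : Fin t, Fin (μ i)) = ∑ i, μ i := by simp
  have hlt : ∀ p, pos p < ∑ i, μ i := by
    intro p
    have hsub : Finset.range (pos p + 1) ⊆ Finset.univ.image pos := by
      intro a ha
      rw [Finset.mem_range] at ha
      obtain ⟨q, hq⟩ := hdown (pos p - a) a ⟨p, by omega⟩
      exact Finset.mem_image.mpr ⟨q, Finset.mem_univ _, hq⟩
    have := Finset.card_le_card hsub
    rw [Finset.card_range, Finset.card_image_of_injective _ hinj, Finset.card_univ, hcard] at this
    omega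
  let F : (Σ i : Fin t, Fin (μ i)) → Fin (∑ i, μ i) := fun p => ⟨pos p, hlt p⟩
  have hF : Function.Bijective F :=
    (Fintype.bijective_iff_injective_and_card F).mpr
      ⟨fun p q hpq => hinj (congrArg Fin.val hpq), by rw [hcard, Fintype.card_fin]⟩
  exact ⟨Equiv.ofBijective F hF, fun p => rfl⟩

/-- Suppose `K` is an infinite field.  There exists a nilpotent `A` commuting with the Jordan
matrix `J` of type `B = (μ_1 ≥ ... ≥ μ_t)` with `A^{n-1} ≠ 0` (where `n = Σ μ_i`;
equivalently `Q(B) = (n)`) if and only if `B` is almost rectangular, i.e. `μ_1 - μ_t ≤ 1`. -/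
theorem QB_full_iff_almost_rectangular
    (K : Type*) [Field K] [Infinite K]
    (t : ℕ) (ht : 0 < t) (μ : Fin t → ℕ) (hpos : ∀ i, 0 < μ i)
    (hmono : ∀ i j : Fin t, i ≤ j → μ j ≤ μ i) :
    (∃ A : Matrix (Σ i : Fin t, Fin (μ i)) (Σ i : Fin t, Fin (μ i)) K,
        A * jordanMatrix K t μ = jordanMatrix K t μ * A ∧ IsNilpotent A ∧
        A ^ ((∑ i, μ i) - 1) ≠ 0) ↔
    μ ⟨0, ht⟩ ≤ μ ⟨t - 1, Nat.sub_lt ht Nat.one_pos⟩ + 1 := by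
  constructor
  · rintro ⟨A, hcomm, hnil, hpow⟩
    by_contra! hlt
    let last : Fin t := ⟨t - 1, Nat.sub_lt ht Nat.one_pos⟩
    let Φ := Matrix.toLinAlgEquiv' (R := K) (n := Σ i : Fin t, Fin (μ i))
    let y : Σ i : Fin t, Fin (μ i) := ⟨last, ⟨0, hpos last⟩⟩
    have hzero : Φ (jordanMatrix K t μ) ^ (μ last + 1) = 0 := by
      refine pow_succ_eq_zero_of_commute_regular (A := Φ A) (hnil.map Φ) ?_ ?_
        (y := Pi.single y 1) ?_ ?_
      · rw [← map_pow, Module.finrank_fintype_fun_eq_card, Fintype.card_sigma]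
        simp only [Fintype.card_fin]
        exact (map_ne_zero_iff Φ Φ.injective).mpr hpow
      · exact (show Commute A _ from hcomm).map Φ
      · ext p
        simp [Φ, Matrix.toLinAlgEquiv'_apply, jordanMatrix, y]
      · intro z hz
        have h1 := congrFun hz y
        rw [← map_pow, Matrix.toLinAlgEquiv'_apply, Pi.single_eq_same] at h1
        refine zero_ne_one (h1.symm.trans ?_).symm
        refine Finset.sum_eq_zero ?_
        rintro ⟨j, b⟩ -
        dsimp only
        rw [jordanMatrix_pow_apply, if_neg, zero_mul]
        rintro ⟨h2, h3⟩
        dsimp only [y] at h2 h3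
        subst h2
        omega
    rw [← map_pow, map_eq_zero_iff Φ Φ.injective] at hzero
    have h0 := hpos ⟨0, ht⟩
    have hentry := congrFun (congrFun hzero ⟨⟨0, ht⟩, ⟨0, h0⟩⟩) ⟨⟨0, ht⟩, ⟨μ last + 1, hlt⟩⟩
    rw [jordanMatrix_pow_apply] at hentry
    simp at hentry
  · intro h
    obtain ⟨e, he⟩ := exists_column_enumeration t ht μ hmono h
    have hn : 0 < ∑ i, μ i :=
      (hpos ⟨0, ht⟩).trans_le (Finset.single_le_sum (fun _ _ => Nat.zero_le _) (Finset.mem_univ _))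
    let Φ := Matrix.reindexAlgEquiv K K e.symm
    let S := shiftMatrix K (∑ i, μ i)
    have happly : ∀ k p q, (Φ S ^ k) p q = if (e p : ℕ) + k = e q then 1 else 0 := by
      intro k p q
      rw [← map_pow, ← shiftMatrix_pow_apply]
      rfl
    have hJ : jordanMatrix K t μ = Φ S ^ t := by
      ext p q
      rw [happly, he, he, jordanMatrix]
      refine if_congr ⟨?_, fun hpq => ?_⟩ rfl rfl
      · rintro ⟨h1, h2⟩
        rw [congrArg Fin.val h1, ← h2]
        ring
      · have h1 : t * ((p.2 : ℕ) + 1) + p.1 = t * q.2 + q.1 := by rw [← hpq]; ring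
        have hmod := congrArg (· % t) h1
        have hdiv := congrArg (· / t) h1
        simp only [Nat.mul_add_mod, Nat.mul_add_div ht, Nat.mod_eq_of_lt (Fin.is_lt _),
          Nat.div_eq_of_lt (Fin.is_lt _), add_zero] at hmod hdiv
        exact ⟨Fin.ext hmod, hdiv⟩
    refine ⟨Φ S, ?_, ⟨∑ i, μ i, ?_⟩, fun hz => ?_⟩
    · rw [hJ, ← pow_succ, ← pow_succ']
    · ext p q
      rw [happly, if_neg (by omega), Matrix.zero_apply]
    · have hentry := congrFun (congrFun hz (e.symm ⟨0, hn⟩))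
        (e.symm ⟨(∑ i, μ i) - 1, Nat.sub_lt hn Nat.one_pos⟩)
      rw [happly] at hentry
      simp at hentry
end
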